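/- Let 0 < m ≤ 1 and let F₀ ∈ C²([0,∞)) be sublinear with 0 ≤ F₀(x) ≤ m·x, satisfying (A1) and (A2). Let F be a function that is Lipschitz on [0,∞)×[0,∞), sublinear in x, satisfies 0 ≤ F(x,t) ≤ m·x, F(x,0) = F₀(x), and is a viscosity solution of (HJ) on (0,∞)×(0,∞). Then for each t ≥ 0 the map x ↦ F(x,t) is concave on [0,∞). -/

import Mathlib

open Set Filter

/-- A function `ψ : [0,∞) → ℝ` is sublinear if `ψ(x)/x → 0` as `x → ∞`. -/
def Sublinear (ψ : ℝ → ℝ) : Prop :=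
  Tendsto (fun x => ψ x / x) atTop (nhds 0)

/-- `F` is sublinear in `x` if `x ↦ F(x,t)` is sublinear for each `t ≥ 0`. -/
def SublinearInX (F : ℝ → ℝ → ℝ) : Prop :=
  ∀ t, 0 ≤ t → Sublinear (fun x => F x t)

/-- Viscosity subsolution of
`∂ₜF + (1/2)(∂ₓF − m)(∂ₓF − m − 1) + F/x − m = 0` on `(0,∞) × (0,∞)`. -/
def IsSubsolutionHJ (m : ℝ) (F : ℝ → ℝ → ℝ) : Prop :=
  ∀ φ : ℝ × ℝ → ℝ, ContDiff ℝ 1 φ →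
    ∀ x₀ t₀ : ℝ, 0 < x₀ → 0 < t₀ →
      IsLocalMaxOn (fun p : ℝ × ℝ => F p.1 p.2 - φ p) (Ici 0 ×ˢ Ici 0) (x₀, t₀) →
      deriv (fun s => φ (x₀, s)) t₀ +
        (1 / 2) * (deriv (fun y => φ (y, t₀)) x₀ - m) *
          (deriv (fun y => φ (y, t₀)) x₀ - m - 1) +
        F x₀ t₀ / x₀ - m ≤ 0

/-- Viscosity supersolution of
`∂ₜF + (1/2)(∂ₓF − m)(∂ₓF − m − 1) + F/x − m = 0` on `(0,∞) × (0,∞)`. -/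
def IsSupersolutionHJ (m : ℝ) (F : ℝ → ℝ → ℝ) : Prop :=
  ∀ φ : ℝ × ℝ → ℝ, ContDiff ℝ 1 φ →
    ∀ x₀ t₀ : ℝ, 0 < x₀ → 0 < t₀ →
      IsLocalMinOn (fun p : ℝ × ℝ => F p.1 p.2 - φ p) (Ici 0 ×ˢ Ici 0) (x₀, t₀) →
      deriv (fun s => φ (x₀, s)) t₀ +
        (1 / 2) * (deriv (fun y => φ (y, t₀)) x₀ - m) *
          (deriv (fun y => φ (y, t₀)) x₀ - m - 1) +
        F x₀ t₀ / x₀ - m ≥ 0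

/-- Viscosity solution of (HJ). -/
def IsSolutionHJ (m : ℝ) (F : ℝ → ℝ → ℝ) : Prop :=
  IsSubsolutionHJ m F ∧ IsSupersolutionHJ m F

/-- A Lipschitz (on the quadrant), sublinear-in-`x` viscosity solution of (HJ)
with `0 ≤ F(x,t) ≤ m·x` and initial data `F₀`. -/
def GoodSolution (m : ℝ) (F₀ : ℝ → ℝ) (F : ℝ → ℝ → ℝ) : Prop :=
  (∃ K : NNReal, LipschitzOnWith K (fun p : ℝ × ℝ => F p.1 p.2) (Ici 0 ×ˢ Ici 0)) ∧
  SublinearInX F ∧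
  (∀ x t : ℝ, 0 ≤ x → 0 ≤ t → 0 ≤ F x t ∧ F x t ≤ m * x) ∧
  (∀ x : ℝ, 0 ≤ x → F x 0 = F₀ x) ∧
  IsSolutionHJ m F

/-- First derivative of `F₀` on `[0,∞)`. -/
noncomputable def D1 (F₀ : ℝ → ℝ) : ℝ → ℝ := derivWithin F₀ (Ici 0)

/-- Second derivative of `F₀` on `[0,∞)`. -/
noncomputable def D2 (F₀ : ℝ → ℝ) : ℝ → ℝ := derivWithin (derivWithin F₀ (Ici 0)) (Ici 0)

/-- The Hamiltonian expression at a maximum of `a F(x,t)` minus a quadratic penalty. -/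
lemma IsSubsolutionHJ.weighted_le {m : ℝ} {F : ℝ → ℝ → ℝ} (hF : IsSubsolutionHJ m F)
    {N δ a x t w z s r : ℝ} (ha : 0 < a) (hx : 0 < x) (ht : 0 < t)
    (hr : r = 2 * N * (a * x + w - z))
    (hmax : ∀ x' t' : ℝ, 0 ≤ x' → 0 ≤ t' →
      a * F x' t' - N * (a * x' + w - z) ^ 2 - N * (t' - s) ^ 2 - δ * x' ≤
        a * F x t - N * (a * x + w - z) ^ 2 - N * (t - s) ^ 2 - δ * x) :
    2 * N * (t - s) + a * (1 / 2 * (r - m) * (r - m - 1) + F x t / x - m) ≤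
      -(r - m - 1 / 2) * δ := by
  set φ : ℝ × ℝ → ℝ := fun p =>
    a⁻¹ * (N * (a * p.1 + w - z) ^ 2 + N * (p.2 - s) ^ 2 + δ * p.1) with hφ
  have hφc : ContDiff ℝ 1 φ := by rw [hφ]; fun_prop
  have hloc : IsLocalMaxOn (fun p : ℝ × ℝ => F p.1 p.2 - φ p) (Ici 0 ×ˢ Ici 0) (x, t) := by
    refine IsMaxOn.localize ?_
    rintro ⟨x', t'⟩ ⟨hx', ht'⟩
    have h := hmax x' t' hx' ht'
    simp only [mem_ofPred_eq, hφ]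
    have key : ∀ A B : ℝ, A - a⁻¹ * B = a⁻¹ * (a * A - B) := by
      intro A B; field_simp
    rw [key, key]
    exact mul_le_mul_of_nonneg_left (by linarith) (inv_pos.2 ha).le
  have h := hF φ hφc x t hx ht hloc
  have d1 : deriv (fun σ => φ (x, σ)) t = a⁻¹ * (2 * N * (t - s)) := by
    have : HasDerivAt (fun σ : ℝ => φ (x, σ))
        (a⁻¹ * (N * (2 * (t - s) ^ 1 * 1))) t := by
      simp only [hφ]
      exact ((((((hasDerivAt_id t).sub_const s).pow 2).const_mul N).const_add
        _).add_const _).const_mul _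
    rw [this.deriv]; ring
  have d2 : deriv (fun y => φ (y, t)) x = r + a⁻¹ * δ := by
    have : HasDerivAt (fun y : ℝ => φ (y, t))
        (a⁻¹ * (N * (2 * (a * x + w - z) ^ 1 * (a * 1)) + δ * 1)) x := by
      simp only [hφ]
      exact (((((((((hasDerivAt_id x).const_mul a).add_const w).sub_const z).pow 2).const_mul
        N).add_const _).add ((hasDerivAt_id x).const_mul δ)).const_mul _)
    rw [this.deriv, hr]; field_simp
  rw [d1, d2] at h
  have h2 := mul_le_mul_of_nonneg_left h ha.le
  have e : a * (a⁻¹ * (2 * N * (t - s)) + 1 / 2 * (r + a⁻¹ * δ - m) * (r + a⁻¹ * δ - m - 1) +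
      F x t / x - m) = 2 * N * (t - s) + a * (1 / 2 * (r - m) * (r - m - 1) + F x t / x - m) +
      (r - m - 1 / 2) * δ + 1 / 2 * (a⁻¹ * δ ^ 2) := by
    field_simp; ring
  rw [e] at h2
  have : 0 ≤ a⁻¹ * δ ^ 2 := by positivity
  linarith

/-- The supersolution inequality at a minimum of `F` plus a quadratic penalty. -/
lemma IsSupersolutionHJ.penalized_ge {m : ℝ} {F : ℝ → ℝ → ℝ} (hF : IsSupersolutionHJ m F)
    {N γ Z t u z s r : ℝ} (hz : 0 < z) (hs : 0 < s) (hr : r = 2 * N * (Z - z))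
    (hmin : ∀ z' s' : ℝ, 0 ≤ z' → 0 ≤ s' →
      F z s + N * (Z - z) ^ 2 + N * (t - s) ^ 2 + N * (u - s) ^ 2 + γ * (s + 1) ^ 2 ≤
        F z' s' + N * (Z - z') ^ 2 + N * (t - s') ^ 2 + N * (u - s') ^ 2 + γ * (s' + 1) ^ 2) :
    0 ≤ 2 * N * (t - s) + 2 * N * (u - s) - 2 * γ * (s + 1) +
      1 / 2 * (r - m) * (r - m - 1) + F z s / z - m := by
  set φ : ℝ × ℝ → ℝ := fun p =>
    -(N * (Z - p.1) ^ 2 + N * (t - p.2) ^ 2 + N * (u - p.2) ^ 2 + γ * (p.2 + 1) ^ 2) with hφ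
  have hφc : ContDiff ℝ 1 φ := by rw [hφ]; fun_prop
  have hloc : IsLocalMinOn (fun p : ℝ × ℝ => F p.1 p.2 - φ p) (Ici 0 ×ˢ Ici 0) (z, s) := by
    refine IsMinOn.localize ?_
    rintro ⟨z', s'⟩ ⟨hz', hs'⟩
    have h := hmin z' s' hz' hs'
    simp only [mem_ofPred_eq, hφ]
    linarith
  have h := hF φ hφc z s hz hs hloc
  have d1 : deriv (fun σ => φ (z, σ)) s =
      2 * N * (t - s) + 2 * N * (u - s) - 2 * γ * (s + 1) := by
    have : HasDerivAt (fun σ : ℝ => φ (z, σ))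
        (-(N * (2 * (t - s) ^ 1 * (-1)) + N * (2 * (u - s) ^ 1 * (-1)) +
          γ * (2 * (s + 1) ^ 1 * 1))) s := by
      simp only [hφ]
      exact ((((((hasDerivAt_id s).const_sub t).pow 2).const_mul N).const_add _).add
        ((((hasDerivAt_id s).const_sub u).pow 2).const_mul N)).add
        ((((hasDerivAt_id s).add_const 1).pow 2).const_mul γ) |>.neg
    rw [this.deriv]; ring
  have d2 : deriv (fun y => φ (y, s)) z = r := by
    have : HasDerivAt (fun y : ℝ => φ (y, s))
        (-(N * (2 * (Z - z) ^ 1 * (-1)))) z := by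
      simp only [hφ]
      exact ((((((((hasDerivAt_id z).const_sub Z).pow 2).const_mul N).add_const _).add_const
        _).add_const _).neg)
    rw [this.deriv, hr]; ring
  rw [d1, d2] at h
  linarith

/-- First-order optimality conditions on the simplex `a, b ≥ 0`, `a + b ≤ 1`. -/
lemma simplex_first_order {N f g x y z a b r : ℝ} (hN : 0 < N)
    (ha : 0 ≤ a) (hb : 0 ≤ b) (hab : a + b ≤ 1) (hr : r = 2 * N * (a * x + b * y - z))
    (hmax : ∀ a' b' : ℝ, 0 ≤ a' → 0 ≤ b' → a' + b' ≤ 1 →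
      a' * f + b' * g - N * (a' * x + b' * y - z) ^ 2 ≤
        a * f + b * g - N * (a * x + b * y - z) ^ 2)
    {a' b' : ℝ} (ha' : 0 ≤ a') (hb' : 0 ≤ b') (hab' : a' + b' ≤ 1) :
    a' * (f - r * x) + b' * (g - r * y) ≤ a * (f - r * x) + b * (g - r * y) := by
  by_contra! hlt
  set L := (a' - a) * (f - r * x) + (b' - b) * (g - r * y) with hL
  have hLpos : 0 < L := by rw [hL]; linarith
  set q := (a' - a) * x + (b' - b) * y with hq
  have hq2 : 0 ≤ N * q ^ 2 := by positivity
  set τ := L / (L + N * q ^ 2) with hτ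
  have hden : 0 < L + N * q ^ 2 := by linarith
  have hτ0 : 0 < τ := div_pos hLpos hden
  have hτ1 : τ ≤ 1 := (div_le_one hden).2 (by linarith)
  have hmul : τ * (L + N * q ^ 2) = L := div_mul_cancel₀ _ hden.ne'
  have h := hmax ((1 - τ) * a + τ * a') ((1 - τ) * b + τ * b')
    (by have : 0 ≤ 1 - τ := by linarith
        positivity)
    (by have : 0 ≤ 1 - τ := by linarith
        positivity)
    (by nlinarith)
  have e : ((1 - τ) * a + τ * a') * f + ((1 - τ) * b + τ * b') * g -
      N * (((1 - τ) * a + τ * a') * x + ((1 - τ) * b + τ * b') * y - z) ^ 2 -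
      (a * f + b * g - N * (a * x + b * y - z) ^ 2) = τ * (L - τ * (N * q ^ 2)) := by
    rw [hL, hq, hr]; ring
  have h3 : τ * (L - τ * (N * q ^ 2)) ≤ 0 := by rw [← e]; linarith
  have h4 : 0 < L - τ * (N * q ^ 2) := by nlinarith [mul_pos hτ0 hLpos]
  nlinarith [mul_pos hτ0 h4]

lemma inv_weighted_le {a b x y : ℝ} (ha : 0 ≤ a) (hb : 0 ≤ b) (hab : a + b = 1)
    (hx : a = 0 ∨ 0 < x) (hy : b = 0 ∨ 0 < y) :
    (a * x + b * y)⁻¹ ≤ a * x⁻¹ + b * y⁻¹ := by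
  rcases hx with rfl | hx
  · obtain rfl : b = 1 := by linarith
    simp
  rcases hy with rfl | hy
  · obtain rfl : a = 1 := by linarith
    simp
  have hZ : 0 < a * x + b * y := by
    rcases ha.eq_or_lt with rfl | h
    · obtain rfl : b = 1 := by linarith
      simpa using hy
    · positivity
  have e : a * x⁻¹ + b * y⁻¹ = (a * y + b * x) / (x * y) := by field_simp
  rw [e, inv_eq_one_div, div_le_div_iff₀ hZ (by positivity)]
  obtain rfl : b = 1 - a := by linarith
  nlinarith [mul_nonneg (mul_nonneg ha hb) (sq_nonneg (x - y))]

/-- A quadratic penalty controls the displacement when the reward is `K`-Lipschitz. -/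
lemma mul_abs_le_of_mul_sq_le {N K d : ℝ} (hK : 0 ≤ K) (h : N * d ^ 2 ≤ K * |d|) :
    N * |d| ≤ K := by
  by_cases hd : d = 0
  · simpa [hd] using hK
  have hp : 0 < |d| := abs_pos.2 hd
  rw [← sq_abs] at h
  nlinarith

/-- The penalized functional whose maximum compares `F` with its concave envelope in `x`. -/
def concavityGap (F : ℝ → ℝ → ℝ) (N δ γ a b x t y u z s : ℝ) : ℝ :=
  a * F x t + b * F y u - F z s - N * (a * x + b * y - z) ^ 2 - N * (t - s) ^ 2
    - N * (u - s) ^ 2 - δ * (x + y) - γ * (s + 1) ^ 2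

/-- The domain of `concavityGap`. -/
def GapDomain (a b x t y u z s : ℝ) : Prop :=
  (0 ≤ a ∧ 0 ≤ b ∧ a + b ≤ 1) ∧ 0 ≤ x ∧ 0 ≤ t ∧ 0 ≤ y ∧ 0 ≤ u ∧ 0 ≤ z ∧ 0 ≤ s

lemma le_one_add_of_sq_le {d B : ℝ} (h : d ^ 2 ≤ B) : d ≤ 1 + B := by
  nlinarith [sq_nonneg (d - 1 / 2)]

/-- On the set where `concavityGap` is nonnegative all variables are bounded. -/
lemma exists_bound_of_concavityGap_nonneg {F : ℝ → ℝ → ℝ} {K C N δ γ : ℝ}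
    (hK : 0 < K) (hC : 0 ≤ C) (hN : 0 < N) (hδ : 0 < δ) (hγ : 0 < γ)
    (hF0 : ∀ x t, 0 ≤ x → 0 ≤ t → 0 ≤ F x t)
    (hFC : ∀ x t, 0 ≤ x → 0 ≤ t → F x t ≤ δ / 2 * x + C + K * t) :
    ∃ R : ℝ, ∀ a b x t y u z s, GapDomain a b x t y u z s →
      0 ≤ concavityGap F N δ γ a b x t y u z s →
      x ≤ R ∧ t ≤ R ∧ y ≤ R ∧ u ≤ R ∧ z ≤ R ∧ s ≤ R := by
  set Q := 2 * C + K ^ 2 / N + 2 * K ^ 2 / γ with hQ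
  have hQ0 : 0 ≤ Q := by positivity
  refine ⟨2 + 2 * (Q / δ) + 4 * (Q / γ) + 4 * (Q / N), ?_⟩
  rintro a b x t y u z s ⟨⟨ha, hb, hab⟩, hx, ht, hy, hu, hz, hs⟩ h
  unfold concavityGap at h
  have h1 : a * F x t ≤ δ / 2 * x + C + K * t :=
    (mul_le_of_le_one_left (hF0 x t hx ht) (by linarith)).trans (hFC x t hx ht)
  have h2 : b * F y u ≤ δ / 2 * y + C + K * u :=
    (mul_le_of_le_one_left (hF0 y u hy hu) (by linarith)).trans (hFC y u hy hu)
  have h3 := hF0 z s hz hs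
  have young : ∀ d : ℝ, K * d ≤ N / 2 * d ^ 2 + K ^ 2 / N / 2 := by
    intro d
    have : N / 2 * d ^ 2 + K ^ 2 / N / 2 - K * d = (N * d - K) ^ 2 / (2 * N) := by
      field_simp; ring
    have : 0 ≤ (N * d - K) ^ 2 / (2 * N) := by positivity
    linarith
  have young' : 2 * K * s ≤ γ / 2 * s ^ 2 + 2 * K ^ 2 / γ := by
    have : γ / 2 * s ^ 2 + 2 * K ^ 2 / γ - 2 * K * s = (γ * s - 2 * K) ^ 2 / (2 * γ) := by
      field_simp; ring
    have : 0 ≤ (γ * s - 2 * K) ^ 2 / (2 * γ) := by positivity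
    linarith
  have y1 := young (t - s)
  have y2 := young (u - s)
  have hgs : γ * s ^ 2 ≤ γ * (s + 1) ^ 2 := by
    apply mul_le_mul_of_nonneg_left _ hγ.le
    nlinarith
  have main : δ / 2 * (x + y) + N / 2 * (t - s) ^ 2 + N / 2 * (u - s) ^ 2 + γ / 2 * s ^ 2 +
      N * (a * x + b * y - z) ^ 2 ≤ Q := by
    rw [hQ]; linarith
  have n1 : 0 ≤ δ / 2 * (x + y) := by positivity
  have n2 : 0 ≤ N / 2 * (t - s) ^ 2 := by positivity
  have n3 : 0 ≤ N / 2 * (u - s) ^ 2 := by positivity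
  have n4 : 0 ≤ γ / 2 * s ^ 2 := by positivity
  have n5 : 0 ≤ N * (a * x + b * y - z) ^ 2 := by positivity
  have b1 : x + y ≤ 2 * (Q / δ) := by
    have : δ * (x + y) ≤ 2 * Q := by linarith
    rw [← mul_div_assoc, le_div_iff₀ hδ]; linarith
  have b2 : t - s ≤ 1 + 2 * (Q / N) := by
    apply le_one_add_of_sq_le
    rw [← mul_div_assoc, le_div_iff₀ hN]; linarith
  have b3 : u - s ≤ 1 + 2 * (Q / N) := by
    apply le_one_add_of_sq_le
    rw [← mul_div_assoc, le_div_iff₀ hN]; linarith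
  have b4 : s ≤ 1 + 2 * (Q / γ) := by
    apply le_one_add_of_sq_le
    rw [← mul_div_assoc, le_div_iff₀ hγ]; linarith
  have b5 : z - (a * x + b * y) ≤ 1 + Q / N := by
    apply le_one_add_of_sq_le
    rw [le_div_iff₀ hN]
    calc _ = N * (a * x + b * y - z) ^ 2 := by ring
      _ ≤ Q := by linarith
  have q1 : 0 ≤ Q / δ := by positivity
  have q2 : 0 ≤ Q / N := by positivity
  have q3 : 0 ≤ Q / γ := by positivity
  have e1 : a * x ≤ x := mul_le_of_le_one_left hx (by linarith)
  have e2 : b * y ≤ y := mul_le_of_le_one_left hy (by linarith)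
  refine ⟨?_, ?_, ?_, ?_, ?_, ?_⟩ <;> linarith

/-- `concavityGap` attains its maximum as soon as it is nonnegative somewhere. -/
lemma exists_max_concavityGap {F : ℝ → ℝ → ℝ} {K C N δ γ : ℝ}
    (hK : 0 < K) (hC : 0 ≤ C) (hN : 0 < N) (hδ : 0 < δ) (hγ : 0 < γ)
    (hcont : ContinuousOn (fun p : ℝ × ℝ => F p.1 p.2) (Ici 0 ×ˢ Ici 0))
    (hF0 : ∀ x t, 0 ≤ x → 0 ≤ t → 0 ≤ F x t)
    (hFC : ∀ x t, 0 ≤ x → 0 ≤ t → F x t ≤ δ / 2 * x + C + K * t)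
    {a₀ b₀ x₀ t₀ y₀ u₀ z₀ s₀ : ℝ} (h₀ : GapDomain a₀ b₀ x₀ t₀ y₀ u₀ z₀ s₀)
    (hpos : 0 ≤ concavityGap F N δ γ a₀ b₀ x₀ t₀ y₀ u₀ z₀ s₀) :
    ∃ a b x t y u z s, GapDomain a b x t y u z s ∧
      ∀ a' b' x' t' y' u' z' s', GapDomain a' b' x' t' y' u' z' s' →
        concavityGap F N δ γ a' b' x' t' y' u' z' s' ≤
          concavityGap F N δ γ a b x t y u z s := by
  obtain ⟨R, hR⟩ := exists_bound_of_concavityGap_nonneg hK hC hN hδ hγ hF0 hFC (N := N)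
  set S : Set ((ℝ × ℝ) × (ℝ × ℝ) × (ℝ × ℝ) × (ℝ × ℝ)) :=
    ({p | 0 ≤ p.1 ∧ 0 ≤ p.2 ∧ p.1 + p.2 ≤ 1} ∩ Icc 0 1) ×ˢ (Icc 0 (R, R)) ×ˢ
      (Icc 0 (R, R)) ×ˢ (Icc 0 (R, R)) with hS
  have hScompact : IsCompact S := by
    refine IsCompact.prod (isCompact_Icc.inter_left ?_)
      (isCompact_Icc.prod (isCompact_Icc.prod isCompact_Icc))
    exact (isClosed_le continuous_const continuous_fst).inter
      ((isClosed_le continuous_const continuous_snd).inter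
        (isClosed_le (continuous_fst.add continuous_snd) continuous_const))
  have hmem : ∀ a b x t y u z s, GapDomain a b x t y u z s →
      0 ≤ concavityGap F N δ γ a b x t y u z s → ((a, b), (x, t), (y, u), (z, s)) ∈ S := by
    intro a b x t y u z s hd h
    obtain ⟨r1, r2, r3, r4, r5, r6⟩ := hR a b x t y u z s hd h
    obtain ⟨⟨ha, hb, hab⟩, hx, ht, hy, hu, hz, hs⟩ := hd
    refine ⟨⟨⟨ha, hb, hab⟩, ⟨ha, hb⟩, ?_, ?_⟩, ⟨⟨hx, ht⟩, r1, r2⟩, ⟨⟨hy, hu⟩, r3, r4⟩,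
      ⟨hz, hs⟩, r5, r6⟩
    · change a ≤ 1; linarith
    · change b ≤ 1; linarith
  have hcF : ∀ f : (ℝ × ℝ) × (ℝ × ℝ) × (ℝ × ℝ) × (ℝ × ℝ) → ℝ × ℝ, Continuous f →
      (∀ v ∈ S, 0 ≤ f v) → ContinuousOn (fun v => F (f v).1 (f v).2) S := by
    intro f hf hfS
    exact hcont.comp hf.continuousOn fun v hv => ⟨(hfS v hv).1, (hfS v hv).2⟩
  have c1 := hcF (fun v => v.2.1) (by fun_prop) fun v hv => hv.2.1.1
  have c2 := hcF (fun v => v.2.2.1) (by fun_prop) fun v hv => hv.2.2.1.1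
  have c3 := hcF (fun v => v.2.2.2) (by fun_prop) fun v hv => hv.2.2.2.1
  have hcont' : ContinuousOn (fun v : (ℝ × ℝ) × (ℝ × ℝ) × (ℝ × ℝ) × (ℝ × ℝ) =>
      concavityGap F N δ γ v.1.1 v.1.2 v.2.1.1 v.2.1.2 v.2.2.1.1 v.2.2.1.2 v.2.2.2.1 v.2.2.2.2)
      S := by
    unfold concavityGap
    have p1 : ContinuousOn (fun v : (ℝ × ℝ) × (ℝ × ℝ) × (ℝ × ℝ) × (ℝ × ℝ) => v.1.1) S := by
      fun_prop
    have p2 : ContinuousOn (fun v : (ℝ × ℝ) × (ℝ × ℝ) × (ℝ × ℝ) × (ℝ × ℝ) => v.1.2) S := by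
      fun_prop
    refine ((((((p1.mul c1).add (p2.mul c2)).sub c3).sub ?_).sub ?_).sub ?_).sub ?_ |>.sub ?_ <;>
      fun_prop
  obtain ⟨v, hvS, hv⟩ := hScompact.exists_isMaxOn ⟨_, hmem _ _ _ _ _ _ _ _ h₀ hpos⟩ hcont'
  have hv' : ∀ a' b' x' t' y' u' z' s', GapDomain a' b' x' t' y' u' z' s' →
      0 ≤ concavityGap F N δ γ a' b' x' t' y' u' z' s' → _ :=
    fun a' b' x' t' y' u' z' s' hd h =>
      isMaxOn_iff.1 hv ((a', b'), (x', t'), (y', u'), (z', s')) (hmem _ _ _ _ _ _ _ _ hd h)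
  refine ⟨v.1.1, v.1.2, v.2.1.1, v.2.1.2, v.2.2.1.1, v.2.2.1.2, v.2.2.2.1, v.2.2.2.2, ?_, ?_⟩
  · obtain ⟨⟨h1, -⟩, ⟨⟨h2, h3⟩, -⟩, ⟨⟨h4, h5⟩, -⟩, ⟨h6, h7⟩, -⟩ := hvS
    exact ⟨h1, h2, h3, h4, h5, h6, h7⟩
  · intro a' b' x' t' y' u' z' s' hd
    rcases le_or_gt 0 (concavityGap F N δ γ a' b' x' t' y' u' z' s') with h | h
    · exact hv' _ _ _ _ _ _ _ _ hd h
    · exact h.le.trans (hpos.trans (hv' _ _ _ _ _ _ _ _ h₀ hpos))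

/-- Contribution of one support point at a maximum of the penalized functional. -/
lemma IsSubsolutionHJ.support_point_le {m : ℝ} {F : ℝ → ℝ → ℝ} (hF : IsSubsolutionHJ m F)
    {K N δ a x t w z s r α : ℝ} (hδ : 0 ≤ δ) (hN : 0 < N) (hm : 0 < m)
    (ha : 0 ≤ a) (hx : 0 ≤ x) (ht : 0 < t) (hs : 0 ≤ s)
    (hzero : ∀ t, 0 ≤ t → F 0 t = 0)
    (hr : r = 2 * N * (a * x + w - z)) (hrK : |r| ≤ 2 * K)
    (hmax : ∀ x' t' : ℝ, 0 ≤ x' → 0 ≤ t' →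
      a * F x' t' - N * (a * x' + w - z) ^ 2 - N * (t' - s) ^ 2 - δ * x' ≤
        a * F x t - N * (a * x + w - z) ^ 2 - N * (t - s) ^ 2 - δ * x)
    (hα : a * (α - (F x t - r * x)) = 0)
    (hα0 : α = 0 → 1 / 2 * (r - m) * (r - m - 1) + r - m ≤ 0) :
    2 * N * (t - s) + a * (1 / 2 * (r - m) * (r - m - 1) + r - m) + α * (a * x⁻¹) ≤
      (2 * K + m + 1) * δ := by
  have hK : 0 ≤ K := by linarith [abs_nonneg r]
  have hts : a = 0 ∨ x = 0 → t = s := by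
    intro h
    have h1 := hmax x s hx hs
    have h2 : a * F x s = a * F x t := by
      rcases h with rfl | rfl
      · simp
      · rw [hzero t ht.le, hzero s hs]
    have h3 : N * (t - s) ^ 2 ≤ 0 := by
      rw [h2, sub_self] at h1; linarith
    have h4 : (t - s) ^ 2 = 0 := le_antisymm (nonpos_of_mul_nonpos_right h3 hN) (sq_nonneg _)
    linarith [pow_eq_zero_iff (two_ne_zero) |>.1 h4]
  have hrhs : 0 ≤ (2 * K + m + 1) * δ := by positivity
  rcases ha.eq_or_lt with h | hapos
  · have := hts (Or.inl h.symm)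
    rw [← h, this]; simpa using hrhs
  have hα' : α = F x t - r * x := by
    have := (mul_eq_zero.1 hα).resolve_left hapos.ne'
    linarith
  rcases hx.eq_or_lt with h | hxpos
  · have h1 := hts (Or.inr h.symm)
    have h2 : α = 0 := by rw [hα', ← h, hzero t ht.le]; simp
    have h3 := mul_nonpos_of_nonneg_of_nonpos ha (hα0 h2)
    rw [h1, h2]
    linarith
  · have h1 := hF.weighted_le hapos hxpos ht hr hmax
    have h2 : F x t / x = r + α * x⁻¹ := by
      rw [hα']; field_simp; ring
    rw [h2] at h1
    have h3 : -(r - m - 1 / 2) * δ ≤ (2 * K + m + 1) * δ := by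
      apply mul_le_mul_of_nonneg_right _ hδ
      linarith [neg_abs_le r]
    linarith

/-- `concavityGap` has no positive maximum when the penalty in `s` dominates. -/
lemma concavityGap_max_lt {m : ℝ} (hm₀ : 0 < m) (hm₁ : m ≤ 1) {F : ℝ → ℝ → ℝ}
    (hsub : IsSubsolutionHJ m F) (hsup : IsSupersolutionHJ m F)
    (hbd : ∀ x t : ℝ, 0 ≤ x → 0 ≤ t → 0 ≤ F x t ∧ F x t ≤ m * x)
    {K M N δ γ : ℝ} (hK : 0 < K) (hM : 0 < M) (hN : 0 < N) (hδ : 0 < δ) (hγ : 0 < γ)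
    (hlipx : ∀ x x' t, 0 ≤ x → 0 ≤ x' → 0 ≤ t → |F x t - F x' t| ≤ K * |x - x'|)
    (hlipt : ∀ x t t', 0 ≤ x → 0 ≤ t → 0 ≤ t' → |F x t - F x t'| ≤ K * |t - t'|)
    (hconc : ConcaveOn ℝ (Ici 0) (fun x => F x 0))
    (hN1 : 7 * K ^ 2 < N * M) (hN2 : m * K < N * M) (hδγ : (2 * K + m + 1) * δ < γ)
    {a b x t y u z s : ℝ} (hd : GapDomain a b x t y u z s)
    (hmax : ∀ a' b' x' t' y' u' z' s', GapDomain a' b' x' t' y' u' z' s' →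
        concavityGap F N δ γ a' b' x' t' y' u' z' s' ≤
          concavityGap F N δ γ a b x t y u z s) :
    concavityGap F N δ γ a b x t y u z s < M := by
  by_contra! hge
  obtain ⟨⟨ha, hb, hab⟩, hx, ht, hy, hu, hz, hs⟩ := hd
  have hzero : ∀ t, 0 ≤ t → F 0 t = 0 := fun t ht =>
    le_antisymm (by simpa using (hbd 0 t le_rfl ht).2) (hbd 0 t le_rfl ht).1
  set Z := a * x + b * y with hZdef
  have hZ0 : 0 ≤ Z := by positivity
  set r := 2 * N * (Z - z) with hr
  -- the penalties control the distances between the points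
  have dZ : N * |Z - z| ≤ K := by
    apply mul_abs_le_of_mul_sq_le hK.le
    have h := hmax a b x t y u Z s ⟨⟨ha, hb, hab⟩, hx, ht, hy, hu, hZ0, hs⟩
    have h' := (le_abs_self _).trans (hlipx Z z s hZ0 hz hs)
    simp only [concavityGap, ← hZdef, sub_self] at h
    linarith
  have dt : N * |t - s| ≤ K := by
    apply mul_abs_le_of_mul_sq_le hK.le
    have h := hmax a b x s y u z s ⟨⟨ha, hb, hab⟩, hx, hs, hy, hu, hz, hs⟩
    have h' := (le_abs_self _).trans (hlipt x t s hx ht hs)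
    have h'' := mul_le_mul_of_nonneg_left h' ha
    have h3 : a * (K * |t - s|) ≤ K * |t - s| :=
      mul_le_of_le_one_left (by positivity) (by linarith)
    simp only [concavityGap, sub_self] at h
    linarith
  have du : N * |u - s| ≤ K := by
    apply mul_abs_le_of_mul_sq_le hK.le
    have h := hmax a b x t y s z s ⟨⟨ha, hb, hab⟩, hx, ht, hy, hs, hz, hs⟩
    have h' := (le_abs_self _).trans (hlipt y u s hy hu hs)
    have h'' := mul_le_mul_of_nonneg_left h' hb
    have h3 : b * (K * |u - s|) ≤ K * |u - s| :=
      mul_le_of_le_one_left (by positivity) (by linarith)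
    simp only [concavityGap, sub_self] at h
    linarith
  have hrK : |r| ≤ 2 * K := by
    rw [hr, abs_mul, abs_of_pos (by positivity : 0 < 2 * N)]; linarith
  -- positivity of the gap without penalties
  have hgap : M ≤ a * F x t + b * F y u - F z s := by
    unfold concavityGap at hge
    have : 0 ≤ N * (a * x + b * y - z) ^ 2 := by positivity
    have : 0 ≤ N * (t - s) ^ 2 := by positivity
    have : 0 ≤ N * (u - s) ^ 2 := by positivity
    have : 0 ≤ δ * (x + y) := by positivity
    have : 0 ≤ γ * (s + 1) ^ 2 := by positivity
    linarith
  have hFx := hbd x t hx ht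
  have hFy := hbd y u hy hu
  have hFz := hbd z s hz hs
  have hZm : a * F x t + b * F y u ≤ m * Z := by
    have h1 := mul_le_mul_of_nonneg_left hFx.2 ha
    have h2 := mul_le_mul_of_nonneg_left hFy.2 hb
    rw [hZdef]; linarith
  have hMZ : M ≤ m * Z := by linarith
  have hZpos : 0 < Z := by
    by_contra! h
    have := mul_nonpos_of_nonneg_of_nonpos hm₀.le h
    linarith
  have hzpos : 0 < z := by
    by_contra! h
    have h0 : z = 0 := le_antisymm h hz
    rw [h0, sub_zero, abs_of_pos hZpos] at dZ
    have h1 := mul_le_mul_of_nonneg_left dZ hm₀.le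
    have h2 := mul_le_mul_of_nonneg_left hMZ hN.le
    linarith
  -- at an initial time the gap would be small
  have htimes : ¬ (t ≤ 2 * (K / N) ∧ u ≤ 2 * (K / N) ∧ s ≤ 2 * (K / N)) := by
    rintro ⟨h1, h2, h3⟩
    have l1 := (abs_le.1 (hlipt x t 0 hx ht le_rfl)).2
    have l2 := (abs_le.1 (hlipt y u 0 hy hu le_rfl)).2
    have l3 := (abs_le.1 (hlipt z s 0 hz hs le_rfl)).1
    have l4 := (abs_le.1 (hlipx Z z 0 hZ0 hz le_rfl)).2
    rw [sub_zero, abs_of_nonneg ht] at l1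
    rw [sub_zero, abs_of_nonneg hu] at l2
    rw [sub_zero, abs_of_nonneg hs] at l3
    have k1 := mul_le_mul_of_nonneg_left l1 ha
    have k2 := mul_le_mul_of_nonneg_left l2 hb
    have k1' : a * (K * t) ≤ K * t := mul_le_of_le_one_left (by positivity) (by linarith)
    have k2' : b * (K * u) ≤ K * u := mul_le_of_le_one_left (by positivity) (by linarith)
    have hJ : a * F x 0 + b * F y 0 ≤ F Z 0 := by
      have hmemx : x ∈ Ici (0 : ℝ) := hx
      have hmemy : y ∈ Ici (0 : ℝ) := hy
      have hmem0 : (0 : ℝ) ∈ Ici (0 : ℝ) := self_mem_Ici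
      rcases (add_nonneg ha hb).eq_or_lt with hc | hc
      · have : Z = 0 := by
          rw [hZdef, show a = 0 by linarith, show b = 0 by linarith]; simp
        linarith
      have hc' : 0 ≤ 1 - (a + b) := by linarith
      have i1 := hconc.2 hmemx hmemy (div_nonneg ha hc.le) (div_nonneg hb hc.le)
        (by field_simp)
      have hw : 0 ≤ a / (a + b) * x + b / (a + b) * y := by positivity
      have hmemw : a / (a + b) * x + b / (a + b) * y ∈ Ici (0 : ℝ) := hw
      have i2 := hconc.2 hmemw hmem0 hc.le hc' (by ring)
      simp only [smul_eq_mul, hzero 0 le_rfl, mul_zero, add_zero] at i1 i2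
      have e : (a + b) * (a / (a + b) * x + b / (a + b) * y) = Z := by
        rw [hZdef]; field_simp
      rw [e] at i2
      have i3 := mul_le_mul_of_nonneg_left i1 hc.le
      have e2 : (a + b) * (a / (a + b) * F x 0 + b / (a + b) * F y 0) =
          a * F x 0 + b * F y 0 := by field_simp
      linarith
    have n1 := mul_le_mul_of_nonneg_left h1 hK.le
    have n2 := mul_le_mul_of_nonneg_left h2 hK.le
    have n3 := mul_le_mul_of_nonneg_left h3 hK.le
    have n4 : |Z - z| ≤ K / N := by rw [le_div_iff₀ hN]; linarith
    have n5 := mul_le_mul_of_nonneg_left n4 hK.le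
    have tot : M ≤ 7 * (K * (K / N)) := by linarith
    have : N * (7 * (K * (K / N))) = 7 * K ^ 2 := by field_simp
    have := mul_le_mul_of_nonneg_left tot hN.le
    linarith
  have hKN : 0 < K / N := by positivity
  have dt' : |t - s| ≤ K / N := by rw [le_div_iff₀ hN]; linarith
  have du' : |u - s| ≤ K / N := by rw [le_div_iff₀ hN]; linarith
  obtain ⟨dt1, dt2⟩ := abs_le.1 dt'
  obtain ⟨du1, du2⟩ := abs_le.1 du'
  have hspos : 0 < s := by
    by_contra! h
    exact htimes ⟨by linarith, by linarith, by linarith⟩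
  have htpos : 0 < t := by
    by_contra! h
    exact htimes ⟨by linarith, by linarith, by linarith⟩
  have hupos : 0 < u := by
    by_contra! h
    exact htimes ⟨by linarith, by linarith, by linarith⟩
  -- optimality in the weights
  have hkkt : ∀ a' b' : ℝ, 0 ≤ a' → 0 ≤ b' → a' + b' ≤ 1 →
      a' * (F x t - r * x) + b' * (F y u - r * y) ≤
        a * (F x t - r * x) + b * (F y u - r * y) := by
    intro a' b' ha' hb' hab'
    refine simplex_first_order hN ha hb hab hr ?_ ha' hb' hab'
    intro a' b' ha' hb' hab'
    have h := hmax a' b' x t y u z s ⟨⟨ha', hb', hab'⟩, hx, ht, hy, hu, hz, hs⟩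
    unfold concavityGap at h
    linarith
  set α := a * (F x t - r * x) + b * (F y u - r * y) with hαdef
  have hα1 : F x t - r * x ≤ α := by simpa using hkkt 1 0 (by simp) (by simp) (by simp)
  have hα2 : F y u - r * y ≤ α := by simpa using hkkt 0 1 (by simp) (by simp) (by simp)
  have hα0 : 0 ≤ α := by simpa using hkkt 0 0 (by simp) (by simp) (by simp)
  have s1 : 0 ≤ a * (α - (F x t - r * x)) := mul_nonneg ha (by linarith)
  have s2 : 0 ≤ b * (α - (F y u - r * y)) := mul_nonneg hb (by linarith)
  have s3 : 0 ≤ (1 - (a + b)) * α := mul_nonneg (by linarith) hα0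
  have ssum : a * (α - (F x t - r * x)) + b * (α - (F y u - r * y)) + (1 - (a + b)) * α = 0 := by
    linear_combination -hαdef
  have t1 : a * (α - (F x t - r * x)) = 0 := by linarith
  have t2 : b * (α - (F y u - r * y)) = 0 := by linarith
  have t3 : (1 - (a + b)) * α = 0 := by linarith
  have hhull : a * F x t + b * F y u = α + r * Z := by
    rw [hZdef]; linear_combination -hαdef
  -- sign of the Hamiltonian along lines through the origin
  have hsign : α = 0 → 1 / 2 * (r - m) * (r - m - 1) + r - m ≤ 0 := by
    intro h
    rw [h, zero_add] at hhull
    have r0 : 0 ≤ r := by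
      by_contra! hneg
      have := mul_neg_of_neg_of_pos hneg hZpos
      linarith
    have r1 : r ≤ m := by
      refine le_of_mul_le_mul_right ?_ hZpos
      linarith
    have := mul_nonneg (by linarith : 0 ≤ m - r) (by linarith : 0 ≤ r - m + 1)
    linarith
  -- viscosity inequalities
  have v1 := hsub.support_point_le (K := K) (w := b * y) hδ.le hN hm₀ ha hx htpos hs hzero
    hr hrK (by
      intro x' t' hx' ht'
      have h := hmax a b x' t' y u z s ⟨⟨ha, hb, hab⟩, hx', ht', hy, hu, hz, hs⟩
      unfold concavityGap at h
      linarith) t1 hsign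
  have v2 := hsub.support_point_le (K := K) (w := a * x) (z := z) (N := N) hδ.le hN hm₀ hb hy
    hupos hs hzero (by rw [hr, hZdef]; ring) hrK (by
      intro x' t' hx' ht'
      have h := hmax a b x t x' t' z s ⟨⟨ha, hb, hab⟩, hx, ht, hx', ht', hz, hs⟩
      unfold concavityGap at h
      rw [add_comm (a * x), add_comm (a * x)] at h
      linarith) t2 hsign
  have v3 := hsup.penalized_ge (N := N) (γ := γ) (Z := Z) (t := t) (u := u) hzpos hspos hr (by
      intro z' s' hz' hs'
      have h := hmax a b x t y u z' s' ⟨⟨ha, hb, hab⟩, hx, ht, hy, hu, hz', hs'⟩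
      unfold concavityGap at h
      linarith)
  -- comparison of the singular terms
  have w1 : F z s / z ≤ r + α * Z⁻¹ := by
    have e : r + α * Z⁻¹ = (α + r * Z) / Z := by field_simp; ring
    rw [e, div_le_div_iff₀ hzpos hZpos]
    have q1 : F z s * (Z - z) ≤ m * z * |Z - z| :=
      (mul_le_mul_of_nonneg_left (le_abs_self _) hFz.1).trans
        (mul_le_mul_of_nonneg_right hFz.2 (abs_nonneg _))
    have q2 : m * |Z - z| ≤ M := by
      have := mul_le_mul_of_nonneg_left dZ hm₀.le
      refine le_of_mul_le_mul_left ?_ hN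
      linarith
    have q3 := mul_le_mul_of_nonneg_left q2 hz
    have q4 := mul_le_mul_of_nonneg_right (show M + F z s ≤ α + r * Z by linarith) hz
    linarith
  have w2 : α * Z⁻¹ ≤ α * (a * x⁻¹ + b * y⁻¹) := by
    rcases hα0.eq_or_lt with h | hpos
    · rw [← h]; simp
    have hab1 : a + b = 1 := by
      have := (mul_eq_zero.1 t3).resolve_right hpos.ne'
      linarith
    refine mul_le_mul_of_nonneg_left (inv_weighted_le ha hb hab1 ?_ ?_) hα0
    · rcases mul_eq_zero.1 t1 with h | h
      · exact Or.inl h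
      · refine Or.inr (hx.lt_of_ne ?_)
        rintro h0
        rw [← h0, hzero t ht] at h
        linarith
    · rcases mul_eq_zero.1 t2 with h | h
      · exact Or.inl h
      · refine Or.inr (hy.lt_of_ne ?_)
        rintro h0
        rw [← h0, hzero u hu] at h
        linarith
  have w3 : (1 - (a + b)) * (1 / 2 * (r - m) * (r - m - 1) + r - m) ≤ 0 := by
    rcases mul_eq_zero.1 t3 with h | h
    · rw [h]; simp
    · exact mul_nonpos_of_nonneg_of_nonpos (by linarith) (hsign h)
  have hγs : 0 ≤ γ * s := by positivity
  linarith

/-- A function bounded by `m x` and sublinear lies below every line of positive slope, up to a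
constant. -/
lemma Sublinear.exists_le_add {ψ : ℝ → ℝ} (hψ : Sublinear ψ) {m η : ℝ} (hm : 0 ≤ m)
    (hη : 0 < η) (hbd : ∀ x, 0 ≤ x → ψ x ≤ m * x) :
    ∃ C, 0 ≤ C ∧ ∀ x, 0 ≤ x → ψ x ≤ η * x + C := by
  obtain ⟨R, hR⟩ := eventually_atTop.1 (hψ.eventually (gt_mem_nhds hη))
  refine ⟨m * |R|, by positivity, fun x hx => ?_⟩
  rcases le_or_gt x |R| with h | h
  · have := mul_le_mul_of_nonneg_left h hm
    have := hbd x hx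
    have : 0 ≤ η * x := by positivity
    linarith
  · have hxpos : 0 < x := (abs_nonneg R).trans_lt h
    have := hR x ((le_abs_self R).trans h.le)
    rw [div_lt_iff₀ hxpos] at this
    have : 0 ≤ m * |R| := by positivity
    linarith

lemma concaveOn_of_D2_nonpos {f : ℝ → ℝ} (hf : ContDiffOn ℝ 2 f (Ici 0))
    (h : ∀ x : ℝ, 0 < x → D2 f x ≤ 0) : ConcaveOn ℝ (Ici 0) f := by
  have heq : ∀ g : ℝ → ℝ, ∀ x : ℝ, 0 < x → derivWithin g (Ici 0) x = deriv g x :=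
    fun g x hx => derivWithin_of_mem_nhds (Ici_mem_nhds hx)
  have hev : ∀ x : ℝ, 0 < x → derivWithin f (Ici 0) =ᶠ[nhds x] deriv f := fun x hx => by
    filter_upwards [Ioi_mem_nhds hx] with y hy using heq f y hy
  have hopen : ContDiffOn ℝ 2 f (Ioi 0) := hf.mono Ioi_subset_Ici_self
  have hd : ContDiffOn ℝ 1 (deriv f) (Ioi 0) := hopen.deriv_of_isOpen isOpen_Ioi (by norm_num)
  refine concaveOn_of_deriv2_nonpos (convex_Ici 0) hf.continuousOn ?_ ?_ ?_
  · rw [interior_Ici]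
    exact hopen.differentiableOn (by norm_num)
  · rw [interior_Ici]
    exact hd.differentiableOn (by norm_num)
  · rw [interior_Ici]
    intro x hx
    have h1 := h x hx
    rw [D2, heq _ x hx, (hev x hx).deriv_eq] at h1
    simpa using h1

/-- Lemma 1.5, concavity of `F` in `x`.
Let `0 < m ≤ 1`, `F₀ ∈ C²([0,∞))` sublinear with `0 ≤ F₀(x) ≤ m·x`, satisfying
(A1): `0 ≤ F₀′ ≤ m`, `F₀′(0) = m`, and (A2): `−C ≤ F₀″ ≤ 0`. If `F` is the Lipschitz,
sublinear-in-`x` viscosity solution of (HJ) with `0 ≤ F ≤ m·x` and `F(·,0) = F₀`, then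
`x ↦ F(x,t)` is concave on `[0,∞)` for each `t ≥ 0`. -/
theorem concavity_in_x (m : ℝ) (hm₀ : 0 < m) (hm₁ : m ≤ 1)
    (F₀ : ℝ → ℝ) (hC2 : ContDiffOn ℝ 2 F₀ (Ici 0))
    (hSub : Sublinear F₀)
    (hBd : ∀ x : ℝ, 0 ≤ x → 0 ≤ F₀ x ∧ F₀ x ≤ m * x)
    (hA1 : (∀ x : ℝ, 0 ≤ x → 0 ≤ D1 F₀ x ∧ D1 F₀ x ≤ m) ∧ D1 F₀ 0 = m)
    (hA2 : ∃ C > 0, ∀ x : ℝ, 0 < x → -C ≤ D2 F₀ x ∧ D2 F₀ x ≤ 0)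
    (F : ℝ → ℝ → ℝ) (hF : GoodSolution m F₀ F) :
    ∀ t : ℝ, 0 ≤ t → ConcaveOn ℝ (Ici 0) (fun x => F x t) := by
  obtain ⟨⟨K₀, hK₀⟩, -, hbd, hinit, hsub, hsup⟩ := hF
  obtain ⟨C₂, -, hC₂⟩ := hA2
  have hconc₀ : ConcaveOn ℝ (Ici 0) F₀ := concaveOn_of_D2_nonpos hC2 fun x hx => (hC₂ x hx).2
  have hconc : ConcaveOn ℝ (Ici 0) (fun x => F x 0) :=
    hconc₀.congr fun x hx => (hinit x hx).symm
  set K : ℝ := K₀ + 1 with hKdef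
  have hK : 0 < K := by positivity
  have hK₀K : (K₀ : ℝ) ≤ K := by rw [hKdef]; linarith
  have hlipx : ∀ x x' t, 0 ≤ x → 0 ≤ x' → 0 ≤ t → |F x t - F x' t| ≤ K * |x - x'| := by
    intro x x' t hx hx' ht
    have h := hK₀.dist_le_mul (x, t) ⟨hx, ht⟩ (x', t) ⟨hx', ht⟩
    rw [Prod.dist_eq, dist_self, max_eq_left dist_nonneg, Real.dist_eq, Real.dist_eq] at h
    exact h.trans (mul_le_mul_of_nonneg_right hK₀K (abs_nonneg _))
  have hlipt : ∀ x t t', 0 ≤ x → 0 ≤ t → 0 ≤ t' → |F x t - F x t'| ≤ K * |t - t'| := by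
    intro x t t' hx ht ht'
    have h := hK₀.dist_le_mul (x, t) ⟨hx, ht⟩ (x, t') ⟨hx, ht'⟩
    rw [Prod.dist_eq, dist_self, max_eq_right dist_nonneg, Real.dist_eq, Real.dist_eq] at h
    exact h.trans (mul_le_mul_of_nonneg_right hK₀K (abs_nonneg _))
  intro T hT
  refine ⟨convex_Ici 0, ?_⟩
  intro x hx y hy a b ha hb hab
  simp only [smul_eq_mul]
  by_contra! hlt
  have hx0 : 0 ≤ x := hx
  have hy0 : 0 ≤ y := hy
  set D := a * F x T + b * F y T - F (a * x + b * y) T with hD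
  have hDpos : 0 < D := by rw [hD]; linarith
  obtain ⟨γ, hγ, hγD⟩ : ∃ γ : ℝ, 0 < γ ∧ γ * (T + 1) ^ 2 ≤ D / 4 :=
    ⟨D / 4 / (T + 1) ^ 2, by positivity, by rw [div_mul_cancel₀]; positivity⟩
  obtain ⟨δ, hδ, hδD, hδγ⟩ :
      ∃ δ : ℝ, 0 < δ ∧ δ * (x + y) ≤ D / 4 ∧ (2 * K + m + 1) * δ < γ := by
    refine ⟨min (D / 4 / (x + y + 1)) (γ / 2 / (2 * K + m + 1)), by positivity, ?_, ?_⟩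
    · have h1 : 0 < x + y + 1 := by positivity
      have h2 := min_le_left (D / 4 / (x + y + 1)) (γ / 2 / (2 * K + m + 1))
      rw [le_div_iff₀ h1] at h2
      have h3 : 0 < min (D / 4 / (x + y + 1)) (γ / 2 / (2 * K + m + 1)) := by positivity
      linarith
    · have h1 : 0 < 2 * K + m + 1 := by positivity
      have h2 := min_le_right (D / 4 / (x + y + 1)) (γ / 2 / (2 * K + m + 1))
      rw [le_div_iff₀ h1] at h2
      linarith
  obtain ⟨N, hN, hN1, hN2⟩ :
      ∃ N : ℝ, 0 < N ∧ 7 * K ^ 2 < N * (D / 2) ∧ m * K < N * (D / 2) := by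
    refine ⟨(7 * K ^ 2 + m * K) / (D / 2) + 1, by positivity, ?_, ?_⟩ <;>
    · rw [add_mul, div_mul_cancel₀ _ (by positivity)]
      have : 0 < K ^ 2 := by positivity
      have : 0 < m * K := by positivity
      linarith
  obtain ⟨C, hC, hFC⟩ := hSub.exists_le_add hm₀.le (half_pos hδ) fun x hx => (hBd x hx).2
  have hdom : GapDomain a b x T y T (a * x + b * y) T :=
    ⟨⟨ha, hb, hab.le⟩, hx0, hT, hy0, hT, by positivity, hT⟩
  have hval : D / 2 ≤ concavityGap F N δ γ a b x T y T (a * x + b * y) T := by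
    simp only [concavityGap, sub_self, ← hD]
    linarith
  obtain ⟨a', b', x', t', y', u', z', s', hd, hmax⟩ :=
    exists_max_concavityGap hK hC hN hδ hγ hK₀.continuousOn
      (fun x t hx ht => (hbd x t hx ht).1)
      (fun x t hx ht => by
        have h1 := (abs_le.1 (hlipt x t 0 hx ht le_rfl)).2
        rw [sub_zero, abs_of_nonneg ht, hinit x hx] at h1
        linarith [hFC x hx])
      hdom (by linarith)
  have hlt' := concavityGap_max_lt hm₀ hm₁ hsub hsup hbd hK (half_pos hDpos) hN hδ hγ hlipx hlipt
    hconc hN1 hN2 hδγ hd hmax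
  have := hmax _ _ _ _ _ _ _ _ hdom
  linarith
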